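/- Let M ≥ 1, let C and D be M×M complex matrices, let w1(1),…,w1(M) and w2(1),…,w2(M−1) be vectors in ℂ^M satisfying −C·w1(i) = D·w2(i) for every i with 1 ≤ i ≤ M−1. Let x1(1),…,x1(M), x3(1),…,x3(M), x2(1),…,x2(M−1), x4(1),…,x4(M−1) be complex scalars; set a(k) = x1(k)+x3(k), b(k) = x2(k)+x4(k), b(0) = 0, s1(k) = a(k)+b(k−1) for k = 1,…,M, s2(k) = a(k)+b(k) for k = 1,…,M−1, and y = C·(Σ_{k=1}^{M} s1(k)·w1(k)) + D·(Σ_{k=1}^{M−1} s2(k)·w2(k)). Let Q be the M×M complex matrix whose k-th column equals D·w2(k) for k = 1,…,M−1 and whose M-th column equals C·w1(M), and assume Q is invertible. Then for every k with 1 ≤ k ≤ M−1, x2(k) = (Σ_{j=1}^{k} (Q⁻¹·y)_j) − x4(k). -/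

import Mathlib

theorem Finset.sum_Icc_one_eq_sum_fin {A : Type*} [AddCommMonoid A] (n : ℕ) (f : ℕ → A) :
    ∑ k ∈ Finset.Icc 1 n, f k = ∑ i : Fin n, f (i.val + 1) := by
  induction n with
  | zero => simp
  | succ n ih => rw [Finset.sum_Icc_succ_top (by omega), ih, Fin.sum_univ_castSucc]; rfl

theorem Fin.sum_filter_val_lt {A : Type*} [AddCommMonoid A] {n k : ℕ} (hk : k ≤ n)
    (f : ℕ → A) :
    ∑ j ∈ Finset.univ.filter (fun j : Fin n => j.val < k), f j.val =
      ∑ j ∈ Finset.range k, f j := by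
  rw [Finset.sum_filter, Fin.sum_univ_eq_sum_range (fun j => if j < k then f j else 0),
    ← Finset.sum_filter]
  congr 1
  ext j
  simp only [Finset.mem_filter, Finset.mem_range]
  omega


open Finset in
/-- Successive decoding at destination D2: summing the first k entries of
Q⁻¹·y (noiseless eq. (36)) and subtracting its own symbol x4(k), D2 recovers
x2(k) for every k = 1,…,M−1. Entries are indexed by Fin M, where index j
corresponds to the (j+1)-st entry (1-based). -/
theorem dest2_successive_decoding (M : ℕ) (hM : 1 ≤ M)
    (C D : Matrix (Fin M) (Fin M) ℂ)
    (w1 w2 : ℕ → Fin M → ℂ)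
    (hcancel : ∀ i : ℕ, 1 ≤ i → i ≤ M - 1 →
      -(C.mulVec (w1 i)) = D.mulVec (w2 i))
    (x1 x3 x2 x4 : ℕ → ℂ)
    (a b : ℕ → ℂ)
    (ha : ∀ k : ℕ, a k = x1 k + x3 k)
    (hb : ∀ k : ℕ, 1 ≤ k → b k = x2 k + x4 k) (hb0 : b 0 = 0)
    (s1 s2 : ℕ → ℂ)
    (hs1 : ∀ k : ℕ, 1 ≤ k → k ≤ M → s1 k = a k + b (k - 1))
    (hs2 : ∀ k : ℕ, 1 ≤ k → k ≤ M - 1 → s2 k = a k + b k)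
    (y : Fin M → ℂ)
    (hy : y = C.mulVec (∑ k ∈ Icc 1 M, s1 k • w1 k) +
      D.mulVec (∑ k ∈ Icc 1 (M - 1), s2 k • w2 k))
    (Q : Matrix (Fin M) (Fin M) ℂ)
    (hQcol : ∀ j k : Fin M, k.val + 1 ≤ M - 1 →
      Q j k = D.mulVec (w2 (k.val + 1)) j)
    (hQlast : ∀ j k : Fin M, k.val = M - 1 → Q j k = C.mulVec (w1 M) j)
    (hQinv : IsUnit Q) :
    ∀ k : ℕ, 1 ≤ k → k ≤ M - 1 →
      x2 k = (∑ j ∈ Finset.univ.filter (fun j : Fin M => j.val < k),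
        Q⁻¹.mulVec y j) - x4 k := by
  obtain ⟨n, rfl⟩ : ∃ n, M = n + 1 := ⟨M - 1, by omega⟩
  simp only [Nat.add_sub_cancel] at *
  let c : ℕ → ℂ := fun j => if j < n then b (j + 1) - b j else s1 (n + 1)
  have hyQ : y = Q.mulVec (fun j => c j.val) := by
    rw [hy, Finset.sum_Icc_succ_top (by omega), Matrix.mulVec_add, Matrix.mulVec_sum,
      Matrix.mulVec_sum, add_right_comm, ← Finset.sum_add_distrib,
      Finset.sum_Icc_one_eq_sum_fin]
    ext r
    rw [Matrix.mulVec, dotProduct, Fin.sum_univ_castSucc, Pi.add_apply, Finset.sum_apply]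
    congr 1
    · refine Finset.sum_congr rfl fun i _ => ?_
      have hi := i.isLt
      have h := congrFun (hcancel (i.val + 1) (by omega) (by omega)) r
      rw [hQcol _ _ (by simp only [Fin.val_castSucc]; omega)]
      simp only [Fin.val_castSucc, c, if_pos hi, Matrix.mulVec_smul, Pi.add_apply,
        Pi.smul_apply, smul_eq_mul, Pi.neg_apply] at h ⊢
      rw [hs1 _ (by omega) (by omega), hs2 _ (by omega) (by omega), ← h, Nat.add_sub_cancel]
      ring
    · rw [hQlast _ _ (by simp)]
      simp [c, Matrix.mulVec_smul, mul_comm]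
  have hz : Q⁻¹.mulVec y = fun j => c j.val := by
    rw [hyQ, Matrix.mulVec_mulVec,
      Matrix.nonsing_inv_mul Q ((Matrix.isUnit_iff_isUnit_det Q).mp hQinv), Matrix.one_mulVec]
  intro k hk hkn
  have hsum : ∑ j ∈ Finset.range k, c j = b k := by
    rw [Finset.sum_congr rfl fun j hj =>
      if_pos (show j < n by have := Finset.mem_range.mp hj; omega),
      Finset.sum_range_sub, hb0, sub_zero]
  rw [hz, Fin.sum_filter_val_lt (by omega) c, hsum, hb k hk, add_sub_cancel_right]
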